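/- arXiv:1102.5574 — 2 statements merged into one kernel-verified Lean document; each statement's English description precedes it below -/
import Mathlib

section
/- Let p_1, ..., p_n be distinct primes, let α_1 ≥ α_2 ≥ ... ≥ α_u > α_{u+1} = ... = α_n = 1 (with u = 0 if all α_i equal 1), and let N = p_1^{α_1}···p_n^{α_n}. For a set D of positive divisors of N, the following three statements are equivalent: (a) D is a maximal N-set of minimum size (i.e. |D| = α_n · ∏_{i=1}^{n-1} (α_i + 1)); (b) D is a maximal N-set with d(D) ⊆ { d : d ∣ p_{u+1}···p_n }; (c) D = { d·d' : d ∣ N/(p_{u+1}···p_n), d' ∈ D' } for some maximal (p_{u+1}···p_n)-set D'. -/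
open Finset

/-- `D` is an `N`-set: a set of positive divisors of `N`, no two elements of which
are coprime. -/
def IsNSet (N : ℕ) (D : Finset ℕ) : Prop :=
  (∀ d ∈ D, d ∣ N) ∧ (∀ d ∈ D, ∀ e ∈ D, Nat.gcd d e ≠ 1)

/-- An `N`-set `D` is maximal if no further divisor of `N` can be added while keeping
the property that no two elements are coprime. -/
def IsMaxNSet (N : ℕ) (D : Finset ℕ) : Prop :=
  IsNSet N D ∧ ∀ l, l ∣ N → l ∉ D → ∃ d ∈ D, Nat.gcd l d = 1

/-- `dSet D` is the set of divisible minimal elements of `D`: those elements of `D`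
not divisible by any other element of `D`. -/
def dSet (D : Finset ℕ) : Finset ℕ :=
  D.filter fun d => ∀ e ∈ D, e ∣ d → e = d

/-- `RSet T N` is `R(T, N)`: the set of positive divisors of `N` divisible by at least
one element of `T`. -/
def RSet (T : Finset ℕ) (N : ℕ) : Finset ℕ :=
  N.divisors.filter fun l => ∃ t ∈ T, t ∣ l

section WeightedUpperSets

variable {ι : Type*} [DecidableEq ι]

/-- The total weight of a family of sets, where only the elements of `A` carry weight. -/
def familyWeight (F : Finset (Finset ι)) (a : ι → ℕ) (A : Finset ι) : ℕ :=
  ∑ S ∈ F, ∏ i ∈ S ∩ A, a i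

/-- Adding a coordinate `j` to the weighted ones changes the normalised weight of an upper set
by the weight of the members of the family for which `j` is pivotal. -/
lemma two_mul_familyWeight_insert (F : Finset (Finset ι)) (a : ι → ℕ)
    (hup : ∀ S ∈ F, ∀ j, insert j S ∈ F) {A : Finset ι} {j : ι} (hj : j ∉ A) :
    2 * familyWeight F a (insert j A) +
        ∑ S ∈ F with j ∈ S ∧ S.erase j ∉ F, ∏ i ∈ S ∩ A, a i =
      (a j + 1) * familyWeight F a A +
        a j * ∑ S ∈ F with j ∈ S ∧ S.erase j ∉ F, ∏ i ∈ S ∩ A, a i := by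
  set E := ∑ S ∈ F with j ∈ S ∧ S.erase j ∉ F, ∏ i ∈ S ∩ A, a i with hE
  set b := ∑ S ∈ F with j ∉ S, ∏ i ∈ S ∩ A, a i with hb
  have hins : ∀ S : Finset ι, insert j S ∩ A = S ∩ A := fun S => by
    rw [insert_inter_of_notMem hj]
  have hbij : ∑ S ∈ F with j ∈ S ∧ S.erase j ∈ F, ∏ i ∈ S ∩ A, a i = b := by
    refine sum_nbij' (fun S => S.erase j) (fun S => insert j S) ?_ ?_ ?_ ?_ ?_
    · intro S hS
      simp_all
    · intro S hS
      simp only [mem_filter] at hS ⊢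
      exact ⟨hup S hS.1 j, mem_insert_self _ _, by rw [erase_insert hS.2]; exact hS.1⟩
    · intro S hS
      exact insert_erase (mem_filter.1 hS).2.1
    · intro S hS
      exact erase_insert (mem_filter.1 hS).2
    · intro S hS
      rw [← hins (S.erase j), insert_erase (mem_filter.1 hS).2.1]
  have ha : ∑ S ∈ F with j ∈ S, ∏ i ∈ S ∩ A, a i = b + E := by
    rw [← sum_filter_add_sum_filter_not (F.filter (j ∈ ·)) (fun S => S.erase j ∈ F),
      filter_filter, filter_filter, hbij]
  have hW : familyWeight F a A = (b + E) + b := by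
    rw [← ha, hb, familyWeight, sum_filter_add_sum_filter_not]
  have hW' : familyWeight F a (insert j A) = a j * (b + E) + b := by
    rw [← ha, hb, familyWeight, ← sum_filter_add_sum_filter_not F (j ∈ ·), mul_sum]
    congr 1
    · refine sum_congr rfl fun S hS => ?_
      rw [inter_insert_of_mem (mem_filter.1 hS).2, prod_insert (by simp [hj])]
    · refine sum_congr rfl fun S hS => ?_
      rw [inter_insert_of_notMem (mem_filter.1 hS).2]
  rw [hW, hW']
  ring

/-- An upper set has normalised weight at least its uniform weight, with equality exactly when
no coordinate of weight larger than one is pivotal. -/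
lemma familyWeight_bound (F : Finset (Finset ι)) (a : ι → ℕ) (ha : ∀ i, 1 ≤ a i)
    (hup : ∀ S ∈ F, ∀ j, insert j S ∈ F) (A : Finset ι) :
    #F * ∏ i ∈ A, (a i + 1) ≤ 2 ^ #A * familyWeight F a A ∧
      (2 ^ #A * familyWeight F a A = #F * ∏ i ∈ A, (a i + 1) ↔
        ∀ j ∈ A, 1 < a j → ∀ S ∈ F, S.erase j ∈ F) := by
  induction A using Finset.induction_on with
  | empty => simp [familyWeight]
  | insert j A hj ih =>
    obtain ⟨hle, hiff⟩ := ih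
    have key := two_mul_familyWeight_insert F a hup hj
    set E := ∑ S ∈ F with j ∈ S ∧ S.erase j ∉ F, ∏ i ∈ S ∩ A, a i with hE
    have hE0 : E = 0 ↔ ∀ S ∈ F, S.erase j ∈ F := by
      rw [hE, sum_eq_zero_iff]
      constructor
      · intro h S hS
        by_cases hjS : j ∈ S
        · by_contra hne
          have h0 := h S (mem_filter.2 ⟨hS, hjS, hne⟩)
          obtain ⟨i, -, hi⟩ := prod_eq_zero_iff.1 h0
          have := ha i
          omega
        · rwa [erase_eq_of_notMem hjS]
      · intro h S hS
        exact absurd (h S (mem_filter.1 hS).1) (mem_filter.1 hS).2.2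
    rw [card_insert_of_notMem hj, prod_insert hj]
    obtain ⟨t, ht⟩ := Nat.exists_eq_add_of_le (ha j)
    set W := familyWeight F a A
    set W' := familyWeight F a (insert j A)
    set Q := ∏ i ∈ A, (a i + 1)
    have hkey : 2 ^ (#A + 1) * W' = (a j + 1) * (2 ^ #A * W) + t * (2 ^ #A * E) := by
      have h2 : 2 * W' = (a j + 1) * W + t * E := by
        rw [ht] at key ⊢
        linarith
      calc 2 ^ (#A + 1) * W' = 2 ^ #A * (2 * W') := by ring
        _ = _ := by rw [h2]; ring
    have hmul : #F * ((a j + 1) * Q) = (a j + 1) * (#F * Q) := by ring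
    have hle' : (a j + 1) * (#F * Q) ≤ (a j + 1) * (2 ^ #A * W) := Nat.mul_le_mul_left _ hle
    rw [hkey, hmul]
    refine ⟨hle'.trans (Nat.le_add_right _ _), ?_⟩
    simp only [mem_insert, forall_eq_or_imp]
    rw [← hiff, ← hE0]
    constructor
    · intro h
      have h1 : (a j + 1) * (2 ^ #A * W) = (a j + 1) * (#F * Q) := by omega
      have h2 : t * (2 ^ #A * E) = 0 := by omega
      refine ⟨fun hlt => ?_, Nat.eq_of_mul_eq_mul_left (Nat.succ_pos _) h1⟩
      have h4 : t ≠ 0 := by omega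
      simpa [h4] using h2
    · rintro ⟨h1, h2⟩
      rw [h2]
      rcases Nat.eq_zero_or_pos t with h0 | h0
      · simp [h0]
      · simp [h1 (by omega)]

end WeightedUpperSets

section MaximalSets

/-- Membership in a maximal `N`-set depends only on the prime divisors, monotonically. -/
lemma IsMaxNSet.mem_of_primes {N : ℕ} {D : Finset ℕ} (hD : IsMaxNSet N D) {d l : ℕ}
    (hd : d ∈ D) (hl : l ∣ N) (h : ∀ q, q.Prime → q ∣ d → q ∣ l) : l ∈ D := by
  by_contra hlD
  obtain ⟨e, he, hle⟩ := hD.2 l hl hlD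
  refine hD.1.2 d hd e he (Nat.Coprime.gcd_eq_one (Nat.coprime_of_dvd fun q hq hqd hqe => ?_))
  exact Nat.Prime.not_coprime_iff_dvd.2 ⟨q, hq, h q hq hqd, hqe⟩ hle

lemma IsMaxNSet.mem_of_dvd {N : ℕ} {D : Finset ℕ} (hD : IsMaxNSet N D) {d l : ℕ}
    (hd : d ∈ D) (hl : l ∣ N) (h : d ∣ l) : l ∈ D :=
  hD.mem_of_primes hd hl fun _ _ hq => hq.trans h

lemma exists_dSet_dvd {D : Finset ℕ} (h0 : 0 ∉ D) {d : ℕ} (hd : d ∈ D) :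
    ∃ e ∈ dSet D, e ∣ d := by
  induction d using Nat.strong_induction_on with
  | _ d ih =>
    by_cases h : ∀ e ∈ D, e ∣ d → e = d
    · exact ⟨d, mem_filter.2 ⟨hd, h⟩, dvd_rfl⟩
    · push Not at h
      obtain ⟨e, he, hed, hne⟩ := h
      have hd0 : 0 < d := Nat.pos_of_ne_zero fun h => h0 (h ▸ hd)
      obtain ⟨f, hf, hfe⟩ := ih e (lt_of_le_of_ne (Nat.le_of_dvd hd0 hed) hne) he
      exact ⟨f, hf, hfe.trans hed⟩

lemma IsMaxNSet.dSet_dvd_iff {N P : ℕ} (hN : N ≠ 0) {D : Finset ℕ} (hD : IsMaxNSet N D) :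
    (∀ d ∈ dSet D, d ∣ P) ↔ ∀ d ∈ D, Nat.gcd d P ∈ D := by
  constructor
  · intro h d hd
    have h0 : 0 ∉ D := fun h0 => hN (zero_dvd_iff.1 (hD.1.1 0 h0))
    obtain ⟨e, he, hed⟩ := exists_dSet_dvd h0 hd
    exact hD.mem_of_dvd (mem_filter.1 he).1 ((Nat.gcd_dvd_left d P).trans (hD.1.1 d hd))
      (Nat.dvd_gcd hed (h e he))
  · intro h d hd
    obtain ⟨hdD, hmin⟩ := mem_filter.1 hd
    rw [← hmin _ (h d hdD) (Nat.gcd_dvd_left d P)]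
    exact Nat.gcd_dvd_right d P

lemma isMaxNSet_mul_iff {Q P : ℕ} (hcop : Nat.Coprime Q P) (hQ : Q ≠ 0) (D : Finset ℕ) :
    (IsMaxNSet (Q * P) D ∧ ∀ d ∈ D, Nat.gcd d P ∈ D) ↔
      ∃ D' : Finset ℕ, IsMaxNSet P D' ∧
        D = (Q.divisors ×ˢ D').image fun x => x.1 * x.2 := by
  constructor
  · rintro ⟨hD, hI⟩
    refine ⟨D.filter (· ∣ P), ⟨⟨fun d hd => (mem_filter.1 hd).2, fun d hd e he =>
      hD.1.2 d (mem_filter.1 hd).1 e (mem_filter.1 he).1⟩, fun l hl hlD => ?_⟩, ?_⟩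
    · obtain ⟨d, hd, hld⟩ := hD.2 l (hl.mul_left Q) fun h => hlD (mem_filter.2 ⟨h, hl⟩)
      exact ⟨_, mem_filter.2 ⟨hI d hd, Nat.gcd_dvd_right _ _⟩,
        Nat.Coprime.coprime_dvd_right (Nat.gcd_dvd_left d P) hld⟩
    · ext d
      simp only [mem_image, mem_product, Nat.mem_divisors, mem_filter, Prod.exists]
      constructor
      · intro hd
        exact ⟨Nat.gcd d Q, Nat.gcd d P, ⟨⟨Nat.gcd_dvd_right _ _, hQ⟩, hI d hd,
          Nat.gcd_dvd_right _ _⟩, by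
            rw [← hcop.gcd_mul d]; exact Nat.gcd_eq_left (hD.1.1 d hd)⟩
      · rintro ⟨x, y, ⟨⟨hx, -⟩, hy, hyP⟩, rfl⟩
        exact hD.mem_of_dvd hy (mul_dvd_mul hx hyP) (dvd_mul_left _ _)
  · rintro ⟨D', hD', rfl⟩
    have hmem : ∀ {d}, d ∈ ((Q.divisors ×ˢ D').image fun x => x.1 * x.2) ↔
        ∃ x y, x ∣ Q ∧ y ∈ D' ∧ x * y = d := by
      simp [hQ, and_assoc]
    refine ⟨⟨⟨fun d hd => ?_, fun d hd e he hde => ?_⟩, fun l hl hlD => ?_⟩, fun d hd => ?_⟩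
    · obtain ⟨x, y, hx, hy, rfl⟩ := hmem.1 hd
      exact mul_dvd_mul hx (hD'.1.1 y hy)
    · obtain ⟨x, y, hx, hy, rfl⟩ := hmem.1 hd
      obtain ⟨x', y', hx', hy', rfl⟩ := hmem.1 he
      exact hD'.1.2 y hy y' hy' (Nat.Coprime.coprime_dvd_left (dvd_mul_left y x)
        (Nat.Coprime.coprime_dvd_right (dvd_mul_left y' x') hde))
    · obtain ⟨y, hy, hly⟩ := hD'.2 (Nat.gcd l P) (Nat.gcd_dvd_right _ _) fun h =>
        hlD (hmem.2 ⟨Nat.gcd l Q, Nat.gcd l P, Nat.gcd_dvd_right _ _, h, by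
          rw [← hcop.gcd_mul l]; exact Nat.gcd_eq_left hl⟩)
      refine ⟨y, hmem.2 ⟨1, y, one_dvd _, hy, one_mul _⟩, ?_⟩
      rwa [Nat.gcd_assoc, Nat.gcd_eq_right (hD'.1.1 y hy)] at hly
    · obtain ⟨x, y, hx, hy, rfl⟩ := hmem.1 hd
      refine hmem.2 ⟨1, y, one_dvd _, hy, ?_⟩
      rw [(hcop.coprime_dvd_left hx).gcd_mul_left_cancel, one_mul,
        Nat.gcd_eq_left (hD'.1.1 y hy)]

end MaximalSets

section PrimeSupports

variable {ι : Type*} {p α : ι → ℕ}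

lemma dvd_prod_primes_iff (hp : ∀ i, (p i).Prime) (hinj : Function.Injective p)
    (S : Finset ι) (j : ι) : p j ∣ ∏ i ∈ S, p i ↔ j ∈ S := by
  rw [(hp j).prime.dvd_finsetProd_iff]
  constructor
  · rintro ⟨i, hi, hji⟩
    rwa [hinj ((Nat.prime_dvd_prime_iff_eq (hp j) (hp i)).1 hji)]
  · exact fun h => ⟨j, h, dvd_rfl⟩

variable [Fintype ι]

lemma prod_primes_dvd (hα : ∀ i, 1 ≤ α i) (S : Finset ι) :
    ∏ i ∈ S, p i ∣ ∏ i, p i ^ α i :=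
  (prod_dvd_prod_of_dvd _ _ fun i _ => dvd_pow_self (p i) (by have := hα i; omega)).trans
    (prod_dvd_prod_of_subset S univ _ (subset_univ S))

lemma factorization_prod_primes_pow (hp : ∀ i, (p i).Prime) (hinj : Function.Injective p)
    (e : ι → ℕ) (j : ι) : (∏ i, p i ^ e i).factorization (p j) = e j := by
  rw [Nat.factorization_prod fun i _ => pow_ne_zero _ (hp i).ne_zero, Finsupp.finsetSum_apply,
    sum_eq_single j]
  · simp [(hp j).factorization_pow]
  · intro i _ hij
    simp [(hp i).factorization_pow, hinj.eq_iff, hij]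
  · simp

lemma exists_eq_of_prime_dvd_prod_pow (hp : ∀ i, (p i).Prime) {q : ℕ} (hq : q.Prime)
    (h : q ∣ ∏ i, p i ^ α i) : ∃ i, q = p i := by
  obtain ⟨i, -, hi⟩ := (hq.prime.dvd_finsetProd_iff _).1 h
  exact ⟨i, (Nat.prime_dvd_prime_iff_eq hq (hp i)).1 (hq.dvd_of_dvd_pow hi)⟩

/-- The index set of the primes dividing `d`. -/
def primeSupport (p : ι → ℕ) (d : ℕ) : Finset ι := univ.filter fun i => p i ∣ d

/-- The family of index sets of the squarefree elements of `D`. -/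
def supportFamily (p : ι → ℕ) (D : Finset ℕ) : Finset (Finset ι) :=
  univ.filter fun S => ∏ i ∈ S, p i ∈ D

variable {D : Finset ℕ}

lemma IsMaxNSet.primeSupport_mem_iff (hp : ∀ i, (p i).Prime) (hinj : Function.Injective p)
    (hα : ∀ i, 1 ≤ α i) (hD : IsMaxNSet (∏ i, p i ^ α i) D) {d : ℕ} (hd : d ∣ ∏ i, p i ^ α i) :
    primeSupport p d ∈ supportFamily p D ↔ d ∈ D := by
  rw [supportFamily, mem_filter, and_iff_right (mem_univ _)]
  constructor
  · refine fun h => hD.mem_of_primes h hd fun q hq hqd => ?_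
    obtain ⟨i, rfl⟩ := exists_eq_of_prime_dvd_prod_pow hp hq (hqd.trans (prod_primes_dvd hα _))
    exact (mem_filter.1 ((dvd_prod_primes_iff hp hinj _ i).1 hqd)).2
  · refine fun h => hD.mem_of_primes h (prod_primes_dvd hα _) fun q hq hqd => ?_
    obtain ⟨i, rfl⟩ := exists_eq_of_prime_dvd_prod_pow hp hq (hqd.trans hd)
    exact (dvd_prod_primes_iff hp hinj _ i).2 (mem_filter.2 ⟨mem_univ _, hqd⟩)

lemma IsMaxNSet.supportFamily_mono (hα : ∀ i, 1 ≤ α i) (hD : IsMaxNSet (∏ i, p i ^ α i) D)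
    {S T : Finset ι} (hS : S ∈ supportFamily p D) (hST : S ⊆ T) : T ∈ supportFamily p D :=
  mem_filter.2 ⟨mem_univ _, hD.mem_of_dvd (mem_filter.1 hS).2 (prod_primes_dvd hα _)
    (prod_dvd_prod_of_subset _ _ _ hST)⟩

variable [DecidableEq ι]

lemma card_divisors_primeSupport_eq (hp : ∀ i, (p i).Prime) (hinj : Function.Injective p)
    (S : Finset ι) :
    #{d ∈ (∏ i, p i ^ α i).divisors | primeSupport p d = S} = ∏ i ∈ S, α i := by
  have hN0 : ∏ i, p i ^ α i ≠ 0 := prod_ne_zero_iff.2 fun i _ => pow_ne_zero _ (hp i).ne_zero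
  have hcard : ∏ i ∈ S, α i =
      #(Fintype.piFinset fun i => if i ∈ S then Icc 1 (α i) else {0}) := by
    rw [Fintype.card_piFinset]
    simp only [apply_ite card, Nat.card_Icc, card_singleton, add_tsub_cancel_right]
    rw [prod_ite_mem, univ_inter]
  rw [hcard]
  refine card_nbij' (fun d i => d.factorization (p i)) (fun e => ∏ i, p i ^ e i) ?_ ?_ ?_ ?_
  · intro d hd
    simp only [coe_filter, Nat.mem_divisors, Set.mem_ofPred_eq] at hd
    obtain ⟨⟨hdN, -⟩, rfl⟩ := hd
    have hd0 := ne_zero_of_dvd_ne_zero hN0 hdN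
    simp only [mem_coe, Fintype.mem_piFinset, primeSupport, mem_filter, mem_univ, true_and]
    intro i
    split_ifs with h
    · rw [mem_Icc]
      refine ⟨(hp i).factorization_pos_of_dvd hd0 h, ?_⟩
      rw [← factorization_prod_primes_pow hp hinj α i]
      exact (Nat.factorization_le_iff_dvd hd0 hN0).2 hdN (p i)
    · simp [Nat.factorization_eq_zero_of_not_dvd h]
  · intro e he
    simp only [mem_coe, Fintype.mem_piFinset] at he
    simp only [coe_filter, Nat.mem_divisors, Set.mem_ofPred_eq]
    refine ⟨⟨prod_dvd_prod_of_dvd _ _ fun i _ => pow_dvd_pow _ ?_, hN0⟩, ?_⟩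
    · have := he i
      split_ifs at this with h
      · exact (mem_Icc.1 this).2
      · simp_all
    · ext i
      have h0 : ∏ i, p i ^ e i ≠ 0 :=
        prod_ne_zero_iff.2 fun i _ => pow_ne_zero _ (hp i).ne_zero
      rw [primeSupport, mem_filter, (hp i).dvd_iff_one_le_factorization h0,
        factorization_prod_primes_pow hp hinj]
      have := he i
      split_ifs at this with h
      · simpa [h] using (mem_Icc.1 this).1
      · simp_all
  · intro d hd
    simp only [coe_filter, Nat.mem_divisors, Set.mem_ofPred_eq] at hd
    have hd0 := ne_zero_of_dvd_ne_zero hN0 hd.1.1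
    have h0 : ∏ i, p i ^ d.factorization (p i) ≠ 0 :=
      prod_ne_zero_iff.2 fun i _ => pow_ne_zero _ (hp i).ne_zero
    refine Nat.eq_of_factorization_eq h0 hd0 fun q => ?_
    by_cases hq : ∃ i, q = p i
    · obtain ⟨i, rfl⟩ := hq
      exact factorization_prod_primes_pow hp hinj _ i
    · by_cases hqp : q.Prime
      · rw [Nat.factorization_eq_zero_of_not_dvd fun h =>
            hq (exists_eq_of_prime_dvd_prod_pow hp hqp h),
          Nat.factorization_eq_zero_of_not_dvd fun h =>
            hq (exists_eq_of_prime_dvd_prod_pow hp hqp (h.trans hd.1.1))]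
      · rw [Nat.factorization_eq_zero_of_not_prime _ hqp,
          Nat.factorization_eq_zero_of_not_prime _ hqp]
  · intro e _
    funext i
    exact factorization_prod_primes_pow hp hinj e i

lemma IsMaxNSet.card_eq_familyWeight (hp : ∀ i, (p i).Prime) (hinj : Function.Injective p)
    (hα : ∀ i, 1 ≤ α i) (hD : IsMaxNSet (∏ i, p i ^ α i) D) :
    #D = familyWeight (supportFamily p D) α univ := by
  have hN0 : ∏ i, p i ^ α i ≠ 0 := prod_ne_zero_iff.2 fun i _ => pow_ne_zero _ (hp i).ne_zero
  rw [familyWeight, card_eq_sum_card_fiberwise (f := primeSupport p)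
    (t := supportFamily p D) fun d hd =>
      (hD.primeSupport_mem_iff hp hinj hα (hD.1.1 d hd)).2 hd]
  refine sum_congr rfl fun S hS => ?_
  rw [inter_univ, ← card_divisors_primeSupport_eq hp hinj S]
  congr 1
  ext d
  simp only [mem_filter, Nat.mem_divisors]
  constructor
  · exact fun h => ⟨⟨hD.1.1 d h.1, hN0⟩, h.2⟩
  · rintro ⟨⟨hd, -⟩, rfl⟩
    exact ⟨(hD.primeSupport_mem_iff hp hinj hα hd).1 hS, rfl⟩

lemma IsMaxNSet.compl_mem_supportFamily_iff (hp : ∀ i, (p i).Prime)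
    (hinj : Function.Injective p) (hα : ∀ i, 1 ≤ α i) (hD : IsMaxNSet (∏ i, p i ^ α i) D)
    (S : Finset ι) : Sᶜ ∈ supportFamily p D ↔ S ∉ supportFamily p D := by
  constructor
  · intro hSc hS
    refine hD.1.2 _ (mem_filter.1 hS).2 _ (mem_filter.1 hSc).2
      (Nat.coprime_of_dvd fun q hq h1 h2 => ?_)
    obtain ⟨i, rfl⟩ := exists_eq_of_prime_dvd_prod_pow hp hq (h1.trans (prod_primes_dvd hα _))
    exact mem_compl.1 ((dvd_prod_primes_iff hp hinj _ i).1 h2)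
      ((dvd_prod_primes_iff hp hinj _ i).1 h1)
  · intro hS
    obtain ⟨d, hd, hSd⟩ := hD.2 (∏ i ∈ S, p i) (prod_primes_dvd hα _) fun h =>
      hS (mem_filter.2 ⟨mem_univ _, h⟩)
    refine hD.supportFamily_mono hα
      ((hD.primeSupport_mem_iff hp hinj hα (hD.1.1 d hd)).2 hd) fun i hi => ?_
    rw [mem_compl]
    exact fun hiS => Nat.Prime.not_coprime_iff_dvd.2
      ⟨p i, hp i, (dvd_prod_primes_iff hp hinj _ i).2 hiS, (mem_filter.1 hi).2⟩ hSd

lemma IsMaxNSet.two_mul_card_supportFamily (hp : ∀ i, (p i).Prime)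
    (hinj : Function.Injective p) (hα : ∀ i, 1 ≤ α i) (hD : IsMaxNSet (∏ i, p i ^ α i) D) :
    2 * #(supportFamily p D) = 2 ^ Fintype.card ι := by
  have hc : #(supportFamily p D)ᶜ = #(supportFamily p D) := by
    refine card_nbij' (fun S => Sᶜ) (fun S => Sᶜ) ?_ ?_ (fun S _ => compl_compl S)
      (fun S _ => compl_compl S)
    · intro S hS
      exact (hD.compl_mem_supportFamily_iff hp hinj hα S).2 (by simpa using hS)
    · intro S hS
      simpa [hD.compl_mem_supportFamily_iff hp hinj hα S] using hS
  rw [← Fintype.card_finset, ← card_add_card_compl (supportFamily p D), hc, two_mul]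

/-- A maximal set consists of at least half of the divisors; equality holds exactly when
membership does not depend on the primes of exponent larger than one. -/
lemma IsMaxNSet.two_mul_card_eq_iff (hp : ∀ i, (p i).Prime) (hinj : Function.Injective p)
    (hα : ∀ i, 1 ≤ α i) (hD : IsMaxNSet (∏ i, p i ^ α i) D) :
    2 * #D = ∏ i, (α i + 1) ↔ ∀ d ∈ D, Nat.gcd d (∏ i with α i = 1, p i) ∈ D := by
  have hF := hD.two_mul_card_supportFamily hp hinj hα
  have hbound := (familyWeight_bound (supportFamily p D) α hα
    (fun S hS j => hD.supportFamily_mono hα hS (subset_insert j S)) univ).2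
  rw [← hD.card_eq_familyWeight hp hinj hα, card_univ, ← hF] at hbound
  have hFpos : 0 < #(supportFamily p D) := by
    have : 0 < 2 ^ Fintype.card ι := by positivity
    omega
  have hcancel : 2 * #D = ∏ i, (α i + 1) ↔
      2 * #(supportFamily p D) * #D = #(supportFamily p D) * ∏ i, (α i + 1) := by
    rw [mul_comm 2 #(supportFamily p D), mul_assoc, Nat.mul_right_inj hFpos.ne']
  rw [hcancel, hbound]
  constructor
  · intro h d hd
    have hremove : ∀ B : Finset ι, (∀ j ∈ B, 1 < α j) →
        primeSupport p d \ B ∈ supportFamily p D := by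
      intro B
      induction B using Finset.induction_on with
      | empty =>
        intro _
        rw [sdiff_empty]
        exact (hD.primeSupport_mem_iff hp hinj hα (hD.1.1 d hd)).2 hd
      | insert j B _ ih =>
        intro hB
        rw [sdiff_insert]
        exact h j (mem_univ _) (hB j (mem_insert_self _ _)) _
          (ih fun i hi => hB i (mem_insert_of_mem hi))
    have hmem := (mem_filter.1 (hremove (univ.filter fun i => 1 < α i) (by simp))).2
    refine hD.mem_of_primes hmem ((Nat.gcd_dvd_left _ _).trans (hD.1.1 d hd))
      fun q hq hqd => ?_
    obtain ⟨i, rfl⟩ := exists_eq_of_prime_dvd_prod_pow hp hq (hqd.trans (prod_primes_dvd hα _))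
    have hi := (dvd_prod_primes_iff hp hinj _ i).1 hqd
    simp only [primeSupport, mem_sdiff, mem_filter, mem_univ, true_and, not_lt] at hi
    exact Nat.dvd_gcd hi.1 ((dvd_prod_primes_iff hp hinj _ i).2
      (mem_filter.2 ⟨mem_univ _, le_antisymm hi.2 (hα i)⟩))
  · intro h j _ hj S hS
    refine mem_filter.2 ⟨mem_univ _, hD.mem_of_primes (h _ (mem_filter.1 hS).2)
      (prod_primes_dvd hα _) fun q hq hqd => ?_⟩
    have hqS := hqd.trans (Nat.gcd_dvd_left _ _)
    obtain ⟨i, rfl⟩ := exists_eq_of_prime_dvd_prod_pow hp hq (hqS.trans (prod_primes_dvd hα _))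
    have hi := (dvd_prod_primes_iff hp hinj _ i).1 (hqd.trans (Nat.gcd_dvd_right _ _))
    have hiα := (mem_filter.1 hi).2
    exact (dvd_prod_primes_iff hp hinj _ i).2
      (mem_erase.2 ⟨by rintro rfl; omega, (dvd_prod_primes_iff hp hinj _ i).1 hqS⟩)

end PrimeSupports

/-- **Theorem 2.** With `α₁ ≥ ⋯ ≥ α_u > α_{u+1} = ⋯ = α_n = 1` (0-indexed) and
`N = p₁^{α₁} ⋯ p_n^{α_n}`, `P = p_{u+1} ⋯ p_n`, for a set `D` of positive divisors of
`N` the following are equivalent: (a) `D` is a maximal `N`-set of minimum size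
`α_n ∏_{i=1}^{n-1} (α_i + 1)`; (b) `D` is a maximal `N`-set with
`d(D) ⊆ {d : d ∣ P}`; (c) `D = {d·d' : d ∣ N/P, d' ∈ D'}` for some maximal
`P`-set `D'`. -/
theorem stmt_2 (n u : ℕ) (hu : u < n) (p α : Fin n → ℕ)
    (hp : ∀ i, (p i).Prime) (hinj : Function.Injective p)
    (hanti : ∀ i j : Fin n, i ≤ j → α j ≤ α i)
    (hconst : ∀ i : Fin n, u ≤ (i : ℕ) → α i = 1)
    (hstrict : ∀ i : Fin n, (i : ℕ) < u → 1 < α i)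
    (N : ℕ) (hN : N = ∏ i, p i ^ α i)
    (P : ℕ) (hP : P = ∏ i ∈ Finset.univ.filter (fun i : Fin n => u ≤ (i : ℕ)), p i)
    (D : Finset ℕ) (hDdvd : ∀ d ∈ D, d ∣ N) :
    ((IsMaxNSet N D ∧
        D.card = α ⟨n - 1, by omega⟩ *
          ∏ i ∈ Finset.univ.erase ⟨n - 1, by omega⟩, (α i + 1)) ↔
      (IsMaxNSet N D ∧ ∀ d ∈ dSet D, d ∣ P)) ∧
    ((IsMaxNSet N D ∧ ∀ d ∈ dSet D, d ∣ P) ↔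
      (∃ D' : Finset ℕ, IsMaxNSet P D' ∧
        D = ((N / P).divisors ×ˢ D').image fun x => x.1 * x.2)) := by
  have hα : ∀ i, 1 ≤ α i := fun i => by
    rcases lt_or_ge (i : ℕ) u with h | h
    · exact (hstrict i h).le
    · exact (hconst i h).ge
  have hfilter : (univ.filter fun i : Fin n => u ≤ (i : ℕ)) = univ.filter fun i => α i = 1 := by
    refine filter_congr fun i _ => ⟨hconst i, fun h => ?_⟩
    by_contra hlt
    have := hstrict i (not_le.1 hlt)
    omega
  rw [hfilter] at hP
  set Q := ∏ i with ¬ α i = 1, p i ^ α i with hQ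
  have hPpos : 0 < P := hP ▸ prod_pos fun i _ => (hp i).pos
  have hQ0 : Q ≠ 0 := prod_ne_zero_iff.2 fun i _ => pow_ne_zero _ (hp i).ne_zero
  have hNQP : N = Q * P := by
    rw [hN, ← prod_filter_mul_prod_filter_not univ (fun i => α i = 1), mul_comm, hP]
    congr 1
    exact prod_congr rfl fun i hi => by rw [(mem_filter.1 hi).2, pow_one]
  have hN0 : N ≠ 0 := hNQP ▸ mul_ne_zero hQ0 hPpos.ne'
  have hcop : Nat.Coprime Q P := by
    rw [hQ, hP]
    refine Nat.Coprime.prod_left fun i hi => Nat.Coprime.prod_right fun j hj =>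
      Nat.Coprime.pow_left _ ((Nat.coprime_primes (hp i) (hp j)).2 fun h => ?_)
    rw [hinj h] at hi
    exact (mem_filter.1 hi).2 (mem_filter.1 hj).2
  have hdiv : N / P = Q := by rw [hNQP, Nat.mul_div_cancel _ hPpos]
  have hlast : α ⟨n - 1, by omega⟩ = 1 := hconst _ (by simp only; omega)
  have hprod : ∏ i, (α i + 1) =
      2 * ∏ i ∈ univ.erase (⟨n - 1, by omega⟩ : Fin n), (α i + 1) := by
    rw [← mul_prod_erase univ _ (mem_univ (⟨n - 1, by omega⟩ : Fin n)), hlast]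
  have hbI : (IsMaxNSet N D ∧ ∀ d ∈ dSet D, d ∣ P) ↔
      (IsMaxNSet N D ∧ ∀ d ∈ D, Nat.gcd d P ∈ D) :=
    and_congr_right fun hD => hD.dSet_dvd_iff hN0
  rw [hbI]
  constructor
  · refine and_congr_right fun hD => ?_
    have hiff := IsMaxNSet.two_mul_card_eq_iff hp hinj hα (hN ▸ hD)
    rw [← hP, hprod] at hiff
    rw [← hiff, hlast, one_mul]
    omega
  · rw [hdiv, ← isMaxNSet_mul_iff hcop hQ0, ← hNQP]
end

section
/- Let p_1, ..., p_n be distinct primes, let α_1 ≥ α_2 ≥ ... ≥ α_u > α_{u+1} = ... = α_n = 1 (with u = 0 if all α_i equal 1), and let N = p_1^{α_1}···p_n^{α_n}. Let D' be a maximal (p_{u+1}···p_n)-set, and set D = { d·d' : d ∣ N/(p_{u+1}···p_n), d' ∈ D' }. Then D is a maximal N-set and |D| = 2^{n-u-1} · ∏_{i=1}^{u} (α_i + 1) = α_n · ∏_{i=1}^{n-1} (α_i + 1). -/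
open Finset

theorem card_divisors_prod_prime_pow {ι : Type*} (s : Finset ι) (p α : ι → ℕ)
    (hp : ∀ i, (p i).Prime) (hinj : Function.Injective p) :
    (∏ i ∈ s, p i ^ α i).divisors.card = ∏ i ∈ s, (α i + 1) := by
  classical
  induction s using Finset.induction_on with
  | empty => simp
  | insert a s ha ih =>
    have hcop : Nat.Coprime (p a ^ α a) (∏ i ∈ s, p i ^ α i) :=
      Nat.Coprime.prod_right fun i hi =>
        Nat.coprime_pow_primes _ _ (hp a) (hp i) fun h => ha (hinj h ▸ hi)
    rw [prod_insert ha, prod_insert ha, hcop.card_divisors_mul, ih, Nat.divisors_prime_pow (hp a)]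
    simp

/-- The complementary divisor of a divisor of a squarefree number `P` lies in a maximal `P`-set
exactly when the divisor itself does not. -/
theorem IsMaxNSet.div_mem_iff {P : ℕ} {D : Finset ℕ} (hP : Squarefree P) (hD : IsMaxNSet P D)
    {l : ℕ} (hl : l ∣ P) : P / l ∈ D ↔ l ∉ D := by
  obtain ⟨⟨hdvd, hgcd⟩, hmax⟩ := hD
  obtain ⟨m, rfl⟩ := hl
  have hl0 : 0 < l := Nat.pos_of_ne_zero fun h => hP.ne_zero (by simp [h])
  rw [Nat.mul_div_cancel_left _ hl0]
  refine ⟨fun hm hl => hgcd l hl m hm (Nat.coprime_of_squarefree_mul hP), fun hl => ?_⟩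
  obtain ⟨d, hd, hld⟩ := hmax l (dvd_mul_right _ _) hl
  have hdm : d ∣ m := (Nat.Coprime.symm hld).dvd_of_dvd_mul_left (hdvd d hd)
  by_contra hm
  obtain ⟨e, he, hme⟩ := hmax m (dvd_mul_left _ _) hm
  exact hgcd d hd e he (Nat.Coprime.coprime_dvd_left hdm hme)

theorem IsMaxNSet.two_mul_card {P : ℕ} {D : Finset ℕ} (hP : Squarefree P)
    (hD : IsMaxNSet P D) : 2 * D.card = P.divisors.card := by
  have hsub : D ⊆ P.divisors := fun d hd => Nat.mem_divisors.2 ⟨hD.1.1 d hd, hP.ne_zero⟩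
  have hcard : D.card = (P.divisors \ D).card := by
    refine card_nbij' (fun l => P / l) (fun l => P / l) ?_ ?_ ?_ ?_
    · intro l hl
      have hlP := hD.1.1 l hl
      have := hD.div_mem_iff hP hlP
      simp only [coe_sdiff, Set.mem_sdiff, mem_coe, Nat.mem_divisors] at hl ⊢
      exact ⟨⟨Nat.div_dvd_of_dvd hlP, hP.ne_zero⟩, by tauto⟩
    · intro l hl
      simp only [coe_sdiff, Set.mem_sdiff, mem_coe, Nat.mem_divisors] at hl ⊢
      exact (hD.div_mem_iff hP hl.1.1).2 hl.2
    · intro l hl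
      exact Nat.div_div_self (hD.1.1 l hl) hP.ne_zero
    · intro l hl
      simp only [coe_sdiff, Set.mem_sdiff, mem_coe, Nat.mem_divisors] at hl
      exact Nat.div_div_self hl.1.1 hP.ne_zero
  have := card_sdiff_add_card_eq_card hsub
  omega

theorem IsMaxNSet.image_mul {M P : ℕ} {D : Finset ℕ} (hM : M ≠ 0) (hMP : Nat.Coprime M P)
    (hD : IsMaxNSet P D) :
    IsMaxNSet (M * P) ((M.divisors ×ˢ D).image fun x => x.1 * x.2) := by
  obtain ⟨⟨hdvd, hgcd⟩, hmax⟩ := hD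
  refine ⟨⟨?_, ?_⟩, ?_⟩
  · simp only [mem_image, mem_product, Nat.mem_divisors, Prod.exists]
    rintro _ ⟨a, x, ⟨⟨ha, -⟩, hx⟩, rfl⟩
    exact mul_dvd_mul ha (hdvd x hx)
  · simp only [mem_image, mem_product, Prod.exists]
    rintro _ ⟨a, x, ⟨-, hx⟩, rfl⟩ _ ⟨b, y, ⟨-, hy⟩, rfl⟩ h
    exact hgcd x hx y hy (Nat.Coprime.coprime_mul_left (Nat.Coprime.coprime_mul_left_right h))
  · intro l hl hlD
    obtain ⟨a, x, ha, hx, rfl⟩ := exists_dvd_and_dvd_of_dvd_mul hl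
    have hxD : x ∉ D := fun h => hlD <| mem_image.2
      ⟨(a, x), mem_product.2 ⟨Nat.mem_divisors.2 ⟨ha, hM⟩, h⟩, rfl⟩
    obtain ⟨e, he, hxe⟩ := hmax x hx hxD
    refine ⟨e, mem_image.2 ⟨(1, e), mem_product.2 ⟨Nat.one_mem_divisors.2 hM, he⟩, one_mul e⟩, ?_⟩
    exact Nat.Coprime.mul_left
      ((hMP.coprime_dvd_left ha).coprime_dvd_right (hdvd e he)) hxe

theorem card_image_mul_of_coprime {M P : ℕ} {D : Finset ℕ} (hMP : Nat.Coprime M P)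
    (hD : ∀ d ∈ D, d ∣ P) :
    ((M.divisors ×ˢ D).image fun x => x.1 * x.2).card = M.divisors.card * D.card := by
  rw [card_image_of_injOn, card_product]
  have gcd_left {a x : ℕ} (ha : a ∣ M) (hx : x ∣ P) : Nat.gcd (a * x) M = a := by
    rw [Nat.Coprime.gcd_mul_right_cancel _ (hMP.symm.coprime_dvd_left hx), Nat.gcd_eq_left ha]
  have gcd_right {a x : ℕ} (ha : a ∣ M) (hx : x ∣ P) : Nat.gcd (a * x) P = x := by
    rw [Nat.Coprime.gcd_mul_left_cancel _ (hMP.coprime_dvd_left ha), Nat.gcd_eq_left hx]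
  rintro ⟨a, x⟩ hax ⟨b, y⟩ hby (h : a * x = b * y)
  simp only [coe_product, Set.mem_prod, mem_coe, Nat.mem_divisors] at hax hby
  have hx := hD x hax.2
  have hy := hD y hby.2
  refine Prod.ext ?_ ?_
  · exact (gcd_left hax.1.1 hx).symm.trans (h ▸ gcd_left hby.1.1 hy)
  · exact (gcd_right hax.1.1 hx).symm.trans (h ▸ gcd_right hby.1.1 hy)

/-- With `α₁ ≥ ⋯ ≥ α_u > α_{u+1} = ⋯ = α_n = 1` (0-indexed), `N = p₁^{α₁} ⋯ p_n^{α_n}`,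
`P = p_{u+1} ⋯ p_n`: if `D'` is a maximal `P`-set and `D = {d·d' : d ∣ N/P, d' ∈ D'}`,
then `D` is a maximal `N`-set of size
`2^{n-u-1} ∏_{i=1}^{u} (α_i + 1) = α_n ∏_{i=1}^{n-1} (α_i + 1)`. -/
theorem stmt_4 (n u : ℕ) (hu : u < n) (p α : Fin n → ℕ)
    (hp : ∀ i, (p i).Prime) (hinj : Function.Injective p)
    (hanti : ∀ i j : Fin n, i ≤ j → α j ≤ α i)
    (hconst : ∀ i : Fin n, u ≤ (i : ℕ) → α i = 1)
    (hstrict : ∀ i : Fin n, (i : ℕ) < u → 1 < α i)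
    (N : ℕ) (hN : N = ∏ i, p i ^ α i)
    (P : ℕ) (hP : P = ∏ i ∈ Finset.univ.filter (fun i : Fin n => u ≤ (i : ℕ)), p i)
    (D' : Finset ℕ) (hD' : IsMaxNSet P D')
    (D : Finset ℕ) (hD : D = ((N / P).divisors ×ˢ D').image fun x => x.1 * x.2) :
    IsMaxNSet N D ∧
    D.card = 2 ^ (n - u - 1) *
      ∏ i ∈ Finset.univ.filter (fun i : Fin n => (i : ℕ) < u), (α i + 1) ∧
    D.card = α ⟨n - 1, by omega⟩ *
      ∏ i ∈ Finset.univ.erase ⟨n - 1, by omega⟩, (α i + 1) := by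
  classical
  have hP' : P = ∏ i ∈ univ.filter (fun i : Fin n => u ≤ (i : ℕ)), p i ^ α i := by
    rw [hP]
    refine prod_congr rfl fun i hi => ?_
    rw [hconst i (mem_filter.1 hi).2, pow_one]
  obtain ⟨M, hM⟩ : ∃ M, M = ∏ i ∈ univ.filter (fun i : Fin n => (i : ℕ) < u), p i ^ α i :=
    ⟨_, rfl⟩
  have hsplit (f : Fin n → ℕ) : (∏ i ∈ univ.filter (fun i : Fin n => (i : ℕ) < u), f i) *
      ∏ i ∈ univ.filter (fun i : Fin n => u ≤ (i : ℕ)), f i = ∏ i, f i := by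
    simpa only [not_lt] using prod_filter_mul_prod_filter_not univ (fun i : Fin n => (i : ℕ) < u) f
  have hNMP : N = M * P := by rw [hN, hM, hP', hsplit]
  have hM0 : M ≠ 0 := by
    rw [hM]
    exact prod_ne_zero_iff.2 fun i _ => pow_ne_zero _ (hp i).ne_zero
  have hsq : Squarefree P := by
    rw [hP]
    refine (Finset.squarefree_prod_of_pairwise_isCoprime ?_) fun i _ => (hp i).prime.squarefree
    intro i _ j _ hij
    exact Nat.coprime_iff_isRelPrime.1 <| (Nat.coprime_primes (hp i) (hp j)).2 (hinj.ne hij)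
  have hMP : Nat.Coprime M P := by
    rw [hM, hP']
    refine Nat.Coprime.prod_left fun i hi => Nat.Coprime.prod_right fun j hj => ?_
    refine Nat.coprime_pow_primes _ _ (hp i) (hp j) fun h => ?_
    have hij := hinj h
    subst hij
    exact absurd (mem_filter.1 hi).2 (not_lt.2 (mem_filter.1 hj).2)
  have hdiv : N / P = M := by
    rw [hNMP, Nat.mul_div_cancel _ (Nat.pos_of_ne_zero hsq.ne_zero)]
  rw [hdiv] at hD
  have hcardM : M.divisors.card =
      ∏ i ∈ univ.filter (fun i : Fin n => (i : ℕ) < u), (α i + 1) := by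
    rw [hM, card_divisors_prod_prime_pow _ p α hp hinj]
  have hcardP : P.divisors.card =
      ∏ i ∈ univ.filter (fun i : Fin n => u ≤ (i : ℕ)), (α i + 1) := by
    rw [hP', card_divisors_prod_prime_pow _ p α hp hinj]
  have hpow : P.divisors.card = 2 * 2 ^ (n - u - 1) := by
    rw [hcardP, prod_congr rfl (g := fun _ => 2)
      fun i hi => by rw [hconst i (mem_filter.1 hi).2], prod_const, ← pow_succ']
    have hcount : (univ.filter fun i : Fin n => u ≤ (i : ℕ)).card = n - u := by
      have : (univ.filter fun i : Fin n => u ≤ (i : ℕ)) = Ici ⟨u, hu⟩ := by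
        ext i
        simp [Fin.le_def]
      rw [this, Fin.card_Ici]
    rw [hcount]
    congr 1
    omega
  have hcardD' := hD'.two_mul_card hsq
  have hcardD : D.card = M.divisors.card * D'.card := by
    rw [hD, card_image_mul_of_coprime hMP hD'.1.1]
  refine ⟨?_, ?_, ?_⟩
  · rw [hNMP, hD]
    exact hD'.image_mul hM0 hMP
  · rw [hcardD, ← hcardM, mul_comm]
    congr 1
    omega
  · have hlast := mul_prod_erase univ (fun i => α i + 1) (mem_univ (⟨n - 1, by omega⟩ : Fin n))
    have hone : α ⟨n - 1, by omega⟩ = 1 := hconst _ (Nat.le_sub_one_of_lt hu)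
    rw [← hsplit, ← hcardM, ← hcardP, ← hcardD', hone] at hlast
    rw [hcardD, hone]
    linarith
end
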